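/- Let K be an algebraically closed field of characteristic zero. Then the field of Puiseux series K⟨⟨t⟩⟩ = ∪_{n≥1} K((t^{1/n})) is an algebraically closed field; in particular it is the algebraic closure of the Laurent series field K((t)). -/

import Mathlib

open Polynomial in
theorem Polynomial.IsDistinguishedAt.dvd_of_coe_dvd {A : Type*} [CommRing A] {I : Ideal A}
    [IsHausdorff I A] {P Q : A[X]} (hQ : Q.IsDistinguishedAt I) (hI : I ≠ ⊤)
    (h : (Q : PowerSeries A) ∣ P) : Q ∣ P := by
  have : Nontrivial A := ⟨⟨0, 1, fun h => hI ((Ideal.eq_top_iff_one I).2 (h ▸ I.zero_mem))⟩⟩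
  obtain ⟨u, hu⟩ := h
  have hnat : Q.natDegree = ((Q : PowerSeries A).map (Ideal.Quotient.mk I)).order.toNat := by
    rw [← hQ.coe_natDegree_eq_order_map Q 1 (by rwa [map_one, ← Ideal.ne_top_iff_one]) (by simp)]
    rfl
  have hdeg : (P %ₘ Q).degree < Q.natDegree := by
    rw [← degree_eq_natDegree hQ.monic.ne_zero]
    exact degree_modByMonic_lt P hQ.monic
  have key := (hQ.isWeierstrassDivisorAt hI).eq_of_mul_add_eq_mul_add
    (q := ((P /ₘ Q : A[X]) : PowerSeries A)) (q' := u) (r := P %ₘ Q) (r' := 0)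
    (hnat ▸ hdeg) (by simp) (by
      rw [← Polynomial.coe_mul, ← Polynomial.coe_add, add_comm, modByMonic_add_div P Q, hu]
      simp)
  exact (modByMonic_eq_zero_iff_dvd hQ.monic).1 key.2

open Polynomial in
theorem Polynomial.Monic.exists_dvd_natDegree_lt_of_coeff_zero_mem {A : Type*} [CommRing A]
    [IsDomain A] [IsLocalRing A] [IsAdicComplete (IsLocalRing.maximalIdeal A) A] {P : A[X]} (hP : P.Monic)
    (h0 : P.coeff 0 ∈ IsLocalRing.maximalIdeal A) {i : ℕ} (hi : i < P.natDegree)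
    (hPi : P.coeff i ∉ IsLocalRing.maximalIdeal A) :
    ∃ Q : A[X], Q.Monic ∧ Q ∣ P ∧ 0 < Q.natDegree ∧ Q.natDegree < P.natDegree := by
  have hne : (P : PowerSeries A).map (IsLocalRing.residue A) ≠ 0 := fun h => hPi <| by
    simpa using congrArg (PowerSeries.coeff i) h
  obtain ⟨Q, u, hd, hu, hmul⟩ := PowerSeries.exists_isWeierstrassFactorization hne
  have hdvd : Q ∣ P := hd.dvd_of_coe_dvd (Ideal.IsPrime.ne_top inferInstance) ⟨u, hmul⟩
  refine ⟨Q, hd.monic, hdvd, ?_, ?_⟩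
  · rw [Nat.pos_iff_ne_zero]
    intro h
    rw [hd.monic.natDegree_eq_zero.1 h] at hmul
    refine h0 ?_
    have := congrArg PowerSeries.constantCoeff hmul
    simp at this
    rw [this]
    exact PowerSeries.isUnit_constantCoeff _ hu
  · refine lt_of_le_of_ne (natDegree_le_of_dvd hdvd hP.ne_zero) fun h => ?_
    have hPQ : P = Q := eq_of_monic_of_dvd_of_natDegree_le hd.monic hP hdvd h.ge
    subst hPQ
    exact hPi (hd.mem hi)

open Polynomial in
theorem Polynomial.exists_monic_dvd_of_depressed {K : Type*} [Field K] [IsAlgClosed K] [CharZero K]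
    {P : (PowerSeries K)[X]} (hP : P.Monic) (hn : 2 ≤ P.natDegree)
    (hdep : P.coeff (P.natDegree - 1) = 0)
    (hX : P.map PowerSeries.constantCoeff ≠ X ^ P.natDegree) :
    ∃ Q : (PowerSeries K)[X], Q.Monic ∧ Q ∣ P ∧ 0 < Q.natDegree ∧ Q.natDegree < P.natDegree := by
  set n := P.natDegree with hn'
  set p := P.map (PowerSeries.constantCoeff (R := K)) with hp
  have hpm : p.Monic := hP.map _
  have hpn : p.natDegree = n := hP.natDegree_map _
  have hmem (x : PowerSeries K) :
      x ∈ IsLocalRing.maximalIdeal (PowerSeries K) ↔ PowerSeries.constantCoeff x = 0 := by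
    rw [PowerSeries.maximalIdeal_eq_span_X, Ideal.mem_span_singleton, PowerSeries.X_dvd_iff]
  have : IsAdicComplete (IsLocalRing.maximalIdeal (PowerSeries K)) (PowerSeries K) := by
    rw [PowerSeries.maximalIdeal_eq_span_X]
    infer_instance
  obtain ⟨a, ha⟩ := IsAlgClosed.exists_root p (by
    rw [degree_eq_natDegree hpm.ne_zero, hpn]; exact_mod_cast by omega)
  set T := taylor (PowerSeries.C a) P with hT
  have hTn : T.natDegree = n := natDegree_taylor _ _
  have hTm : T.Monic := by
    rw [Monic, hT, leadingCoeff_taylor]; exact hP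
  have hTmap : T.map (PowerSeries.constantCoeff (R := K)) = taylor a p := by
    rw [hT, hp, taylor_apply, taylor_apply, map_comp]; simp
  have hT0 : T.coeff 0 ∈ IsLocalRing.maximalIdeal (PowerSeries K) := by
    rw [hmem, ← coeff_map, hTmap, taylor_coeff_zero]; exact ha
  obtain ⟨i, hi, hTi⟩ : ∃ i < T.natDegree,
      T.coeff i ∉ IsLocalRing.maximalIdeal (PowerSeries K) := by
    by_contra! hcon
    have h1 : taylor a p = X ^ n := by
      rw [← hTmap]
      ext i
      rw [coeff_map, coeff_X_pow]
      rcases lt_trichotomy i n with h | h | h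
      · rw [if_neg h.ne, ← hmem]; exact hcon i (hTn ▸ h)
      · have : T.coeff n = 1 := by rw [← hTn]; exact hTm
        rw [h, this]; simp
      · rw [coeff_eq_zero_of_natDegree_lt (hTn ▸ h), if_neg h.ne', map_zero]
    have h2 : p = (X - C a) ^ n := by
      have := congrArg (taylor (-a)) h1
      rw [taylor_taylor] at this
      simpa [sub_eq_add_neg] using this
    have h3 : p.coeff (n - 1) = 0 := by rw [hp, coeff_map, hdep, map_zero]
    rw [h2, sub_eq_add_neg, ← C_neg, coeff_X_add_C_pow, show n - (n - 1) = 1 by omega,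
      Nat.choose_symm (show 1 ≤ n by omega)] at h3
    have ha0 : a = 0 := by
      have : (n : K) ≠ 0 := by exact_mod_cast by omega
      simpa [this] using h3
    exact hX (by rw [h2, ha0]; simp)
  obtain ⟨Q, hQm, hQd, hQ0, hQn⟩ :=
    hTm.exists_dvd_natDegree_lt_of_coeff_zero_mem hT0 hi hTi
  refine ⟨taylor (-PowerSeries.C a) Q, ?_, ?_, ?_, ?_⟩
  · rw [Monic, leadingCoeff_taylor]; exact hQm
  · obtain ⟨R, hR⟩ := hQd
    refine ⟨taylor (-PowerSeries.C a) R, ?_⟩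
    rw [← taylor_mul, ← hR, hT, taylor_taylor]
    simp
  · rwa [natDegree_taylor]
  · rwa [natDegree_taylor, ← hTn]

open Polynomial in
theorem IsAlgClosed.of_powerSeries_models {K F : Type*} [Field K] [IsAlgClosed K] [CharZero K]
    [Field F] [CharZero F]
    (H : ∀ p : F[X], p.Monic → p ≠ X ^ p.natDegree →
      ∃ (s : F) (φ : PowerSeries K →+* F) (P : (PowerSeries K)[X]), s ≠ 0 ∧
        Function.Injective φ ∧ P.map φ = p.scaleRoots s ∧
        P.map PowerSeries.constantCoeff ≠ X ^ P.natDegree) : IsAlgClosed F := by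
  have main : ∀ n : ℕ, ∀ p : F[X], p.Monic → p.natDegree = n → 0 < n → ∃ x, p.eval x = 0 := by
    intro n
    induction n using Nat.strong_induction_on with
    | _ n ih =>
    intro p hpm hpn hn
    rcases (show n = 1 ∨ 2 ≤ n by omega) with rfl | h2
    · exact exists_root_of_degree_eq_one (by rw [degree_eq_natDegree hpm.ne_zero, hpn]; rfl)
    set c : F := -(p.coeff (n - 1) / n) with hc
    have hn0 : (n : F) ≠ 0 := by exact_mod_cast by omega
    set q := taylor c p with hq
    have hqm : q.Monic := by rw [Monic, hq, leadingCoeff_taylor]; exact hpm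
    have hqn : q.natDegree = n := (natDegree_taylor _ _).trans hpn
    have hqc : q.coeff (n - 1) = 0 := by
      have hd : (hasseDeriv (n - 1) p).natDegree < 2 := by
        have := natDegree_hasseDeriv_le p (n - 1)
        omega
      have h1 : p.coeff n = 1 := hpn ▸ hpm
      rw [hq, taylor_coeff, eval_eq_sum_range' hd, Finset.sum_range_succ, Finset.sum_range_one,
        hasseDeriv_coeff, hasseDeriv_coeff, show 1 + (n - 1) = n by omega,
        Nat.choose_symm (show 1 ≤ n by omega), h1, hc]
      simp
      field_simp
      ring
    suffices ∃ x, q.eval x = 0 by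
      obtain ⟨x, hx⟩ := this
      exact ⟨x + c, by rwa [hq, taylor_eval] at hx⟩
    by_cases hqX : q = X ^ q.natDegree
    · exact ⟨0, by rw [hqX, hqn]; simp [hn.ne']⟩
    obtain ⟨s, φ, P, hs, hφ, hP, hPX⟩ := H q hqm hqX
    have hPn : P.natDegree = n := by
      rw [← natDegree_map_eq_of_injective hφ, hP, natDegree_scaleRoots, hqn]
    have hPm : P.Monic := by
      apply monic_of_injective hφ
      rw [hP, monic_scaleRoots_iff]; exact hqm
    obtain ⟨Q, hQm, hQd, hQ0, hQn⟩ := Polynomial.exists_monic_dvd_of_depressed hPm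
      (hPn ▸ h2) (hφ (by rw [← coeff_map, hP, hPn, coeff_scaleRoots, hqc]; simp)) hPX
    obtain ⟨x, hx⟩ := ih Q.natDegree (hPn ▸ hQn) (Q.map φ) (hQm.map φ) (hQm.natDegree_map φ) hQ0
    have hx' : (q.scaleRoots s).eval x = 0 := by
      rw [← hP]; exact eval_eq_zero_of_dvd_of_eval_eq_zero (map_dvd φ hQd) hx
    refine ⟨x / s, ?_⟩
    have := scaleRoots_eval_mul q (x / s) s
    rw [mul_div_cancel₀ _ hs, hx'] at this
    simpa [hs] using this.symm
  refine IsAlgClosed.of_exists_root _ fun p hp hirr => main _ p hp rfl hirr.natDegree_pos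

namespace HahnSeries

variable {K : Type*} [Field K]

/-- The Hahn series `∑ x_{f g} t^g` obtained by reindexing along a strictly monotone map. -/
def comapDomain {Γ Γ' R : Type*} [LinearOrder Γ] [LinearOrder Γ'] [Zero R] (f : Γ → Γ')
    (hf : StrictMono f) (x : HahnSeries Γ' R) : HahnSeries Γ R where
  coeff g := x.coeff (f g)
  isPWO_support' := by
    rw [Set.isPWO_iff_isWF]
    have h : (f '' Function.support fun g => x.coeff (f g)).IsWF :=
      x.isWF_support.mono (by rintro _ ⟨g, hg, rfl⟩; exact hg)
    have h' := Set.wellFoundedOn_image.1 h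
    exact h'.mono (fun a b hab => hf hab) le_rfl

/-- For strictly monotone additive `f`, the image of `embDomain` consists of the series
supported on the range of `f`. -/
theorem mem_range_embDomainRingHom_iff {Γ Γ' R : Type*} [AddCommMonoid Γ] [LinearOrder Γ]
    [IsOrderedCancelAddMonoid Γ] [AddCommMonoid Γ'] [LinearOrder Γ'] [IsOrderedCancelAddMonoid Γ']
    [Semiring R] (f : Γ →+ Γ') (hf : StrictMono f) (x : HahnSeries Γ' R) :
    x ∈ Set.range (embDomainRingHom (R := R) f hf.injective fun _ _ => hf.le_iff_le) ↔
      x.support ⊆ Set.range f := by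
  constructor
  · rintro ⟨y, rfl⟩ q hq
    exact Set.image_subset_range _ _ (support_embDomain_subset hq)
  · intro h
    refine ⟨x.comapDomain f hf, ?_⟩
    ext q
    by_cases hq : q ∈ Set.range f
    · obtain ⟨g, rfl⟩ := hq
      exact embDomain_mk_coeff _ _
    · trans 0
      · exact embDomain_of_notMem_range hq
      · by_contra hne
        exact hq (h (Ne.symm hne))

/-- `m ↦ m / n` as an additive map `ℤ → ℚ`. -/
def intDivHom (n : ℕ+) : ℤ →+ ℚ where
  toFun m := m / (n : ℕ)
  map_zero' := by simp
  map_add' a b := by push_cast; ring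

theorem intDivHom_strictMono (n : ℕ+) : StrictMono (intDivHom n) := fun a b h => by
  have hn : (0 : ℚ) < (n : ℕ) := by exact_mod_cast n.pos
  exact div_lt_div_of_pos_right (by exact_mod_cast h) hn

/-- `m ↦ m / n` as an additive map `ℕ → ℚ`. -/
def natDivHom (n : ℕ+) : ℕ →+ ℚ := (intDivHom n).comp (Nat.castAddMonoidHom ℤ)

theorem natDivHom_strictMono (n : ℕ+) : StrictMono (natDivHom n) :=
  (intDivHom_strictMono n).comp Nat.strictMono_cast

variable (K)

/-- The embedding of `K((t^{1/n}))` in the field of Hahn series. -/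
noncomputable def laurentRoot (n : ℕ+) : HahnSeries ℤ K →+* HahnSeries ℚ K :=
  embDomainRingHom (intDivHom n) (intDivHom_strictMono n).injective
    fun _ _ => (intDivHom_strictMono n).le_iff_le

/-- The embedding of `K[[t^{1/n}]]` in the field of Hahn series. -/
noncomputable def powerSeriesRoot (n : ℕ+) : PowerSeries K →+* HahnSeries ℚ K :=
  (embDomainRingHom (natDivHom n) (natDivHom_strictMono n).injective
    fun _ _ => (natDivHom_strictMono n).le_iff_le).comp (toPowerSeries (R := K)).symm.toRingHom

variable {K}

theorem powerSeriesRoot_injective (n : ℕ+) : Function.Injective (powerSeriesRoot K n) :=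
  embDomain_injective.comp toPowerSeries.symm.injective

theorem coeff_zero_powerSeriesRoot (n : ℕ+) (y : PowerSeries K) :
    (powerSeriesRoot K n y).coeff 0 = PowerSeries.constantCoeff y := by
  have h := embDomain_mk_coeff (R := K) (f := natDivHom n) (natDivHom_strictMono n).injective
    (fun _ _ => (natDivHom_strictMono n).le_iff_le) (x := toPowerSeries.symm y) (a := 0)
  rw [map_zero] at h
  refine Eq.trans h ?_
  simp

theorem mem_fieldRange_laurentRoot_iff {n : ℕ+} {x : HahnSeries ℚ K} :
    x ∈ (laurentRoot K n).fieldRange ↔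
      ∀ q ∈ x.support, ∃ m : ℤ, q = (m : ℚ) / ((n : ℕ) : ℚ) := by
  rw [RingHom.mem_fieldRange]
  refine (mem_range_embDomainRingHom_iff _ (intDivHom_strictMono n) x).trans ?_
  exact forall₂_congr fun q _ => exists_congr fun m => eq_comm

theorem mem_range_powerSeriesRoot {n : ℕ+} {x : HahnSeries ℚ K}
    (hx : x ∈ (laurentRoot K n).fieldRange) (h0 : ∀ q < 0, x.coeff q = 0) :
    x ∈ Set.range (powerSeriesRoot K n) := by
  have hn : (0 : ℚ) < (n : ℕ) := by exact_mod_cast n.pos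
  rw [mem_fieldRange_laurentRoot_iff] at hx
  obtain ⟨y, hy⟩ := (mem_range_embDomainRingHom_iff _ (natDivHom_strictMono n) x).2 fun q hq => by
    obtain ⟨m, rfl⟩ := hx q hq
    have hm : 0 ≤ m := by
      by_contra! hlt
      exact hq (h0 _ (div_neg_of_neg_of_pos (by exact_mod_cast hlt) hn))
    lift m to ℕ using hm
    exact ⟨m, rfl⟩
  exact ⟨toPowerSeries y, by
    rw [← hy]
    exact congrArg (embDomainRingHom _ _ _) (toPowerSeries.symm_apply_apply y)⟩

theorem fieldRange_laurentRoot_mono {m n : ℕ+} (h : m ∣ n) :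
    (laurentRoot K m).fieldRange ≤ (laurentRoot K n).fieldRange := by
  intro x hx
  rw [mem_fieldRange_laurentRoot_iff] at hx ⊢
  intro q hq
  obtain ⟨a, rfl⟩ := hx q hq
  obtain ⟨k, rfl⟩ := h
  refine ⟨a * (k : ℕ), ?_⟩
  have := m.ne_zero
  have := k.ne_zero
  push_cast
  field_simp

variable (K)

/-- The field of Puiseux series, as a subfield of the Hahn series with rational exponents. -/
noncomputable def puiseux : Subfield (HahnSeries ℚ K) := ⨆ n : ℕ+, (laurentRoot K n).fieldRange

variable {K}

theorem mem_puiseux {x : HahnSeries ℚ K} :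
    x ∈ puiseux K ↔ ∃ n : ℕ+, x ∈ (laurentRoot K n).fieldRange :=
  Subfield.mem_iSup_of_directed fun m n =>
    ⟨m * n, fieldRange_laurentRoot_mono (dvd_mul_right m n),
      fieldRange_laurentRoot_mono (dvd_mul_left n m)⟩

theorem powerSeriesRoot_mem_puiseux (n : ℕ+) (y : PowerSeries K) :
    powerSeriesRoot K n y ∈ puiseux K := by
  refine mem_puiseux.2 ⟨n, mem_fieldRange_laurentRoot_iff.2 fun q hq => ?_⟩
  obtain ⟨k, rfl⟩ := (mem_range_embDomainRingHom_iff _ (natDivHom_strictMono n) _).1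
    ⟨toPowerSeries.symm y, rfl⟩ hq
  exact ⟨k, rfl⟩

theorem exists_forall_mem_fieldRange_laurentRoot {ι : Type*} (s : Finset ι) (c : ι → HahnSeries ℚ K)
    (hc : ∀ i, c i ∈ puiseux K) : ∃ n : ℕ+, ∀ i ∈ s, c i ∈ (laurentRoot K n).fieldRange := by
  choose N hN using fun i => mem_puiseux.1 (hc i)
  exact ⟨∏ i ∈ s, N i, fun i hi => fieldRange_laurentRoot_mono (Finset.dvd_prod_of_mem N hi) (hN i)⟩

theorem single_mem_puiseux (q : ℚ) (r : K) : single q r ∈ puiseux K := by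
  refine mem_puiseux.2 ⟨⟨q.den, q.den_pos⟩, mem_fieldRange_laurentRoot_iff.2 fun a ha => ?_⟩
  have : a = q := by simpa using support_single_subset ha
  exact ⟨q.num, by rw [this]; exact (Rat.num_div_den q).symm⟩

open Polynomial in
open scoped Classical in
theorem exists_map_powerSeries_eq_scaleRoots {p : (puiseux K)[X]} (hp : p.Monic)
    (hpX : p ≠ X ^ p.natDegree) :
    ∃ (s : puiseux K) (φ : PowerSeries K →+* puiseux K) (P : (PowerSeries K)[X]), s ≠ 0 ∧
      Function.Injective φ ∧ P.map φ = p.scaleRoots s ∧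
      P.map PowerSeries.constantCoeff ≠ X ^ P.natDegree := by
  set n := p.natDegree with hn
  let S := (Finset.range n).filter fun i => p.coeff i ≠ 0
  have hS : S.Nonempty := by
    rw [Finset.nonempty_iff_ne_empty]
    intro h
    apply hpX
    ext1 i
    rw [coeff_X_pow]
    rcases lt_trichotomy i n with hi | rfl | hi
    · rw [if_neg hi.ne]
      by_contra hne
      exact Finset.notMem_empty i (h ▸ by simp [S, hi, hne])
    · rw [if_pos rfl]; exact hp
    · rw [if_neg hi.ne', coeff_eq_zero_of_natDegree_lt hi]
  obtain ⟨j, hjS, hj⟩ := S.exists_min_image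
    (fun i => (p.coeff i : HahnSeries ℚ K).order / ((n - i : ℕ) : ℚ)) hS
  set q : ℚ := (p.coeff j : HahnSeries ℚ K).order / ((n - j : ℕ) : ℚ) with hq
  obtain ⟨hjn, hj0⟩ : j < n ∧ p.coeff j ≠ 0 := by simpa [S] using hjS
  let s : puiseux K := ⟨single (-q) 1, single_mem_puiseux _ _⟩
  have hcoeff (i : ℕ) (a : ℚ) : ((p.scaleRoots s).coeff i : HahnSeries ℚ K).coeff a =
      (p.coeff i : HahnSeries ℚ K).coeff (a + (n - i : ℕ) * q) := by
    rw [coeff_scaleRoots]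
    have h1 : ((p.coeff i * s ^ (p.natDegree - i) : puiseux K) : HahnSeries ℚ K) =
        (p.coeff i : HahnSeries ℚ K) * single (-((n - i : ℕ) * q)) 1 := by
      push_cast
      simp [s, single_pow, hn]
    have h2 := coeff_mul_single_add (r := (1 : K)) (x := (p.coeff i : HahnSeries ℚ K))
      (a := a + (n - i : ℕ) * q) (b := -((n - i : ℕ) * q))
    rw [h1]
    simpa using h2
  obtain ⟨N, hN⟩ := exists_forall_mem_fieldRange_laurentRoot (Finset.range (n + 1))
    (fun i => ((p.scaleRoots s).coeff i : HahnSeries ℚ K)) (fun i => Subtype.property _)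
  let φ : PowerSeries K →+* puiseux K :=
    (powerSeriesRoot K N).codRestrict (puiseux K) (powerSeriesRoot_mem_puiseux N)
  have hφ : Function.Injective φ := fun a b hab =>
    powerSeriesRoot_injective N (congrArg Subtype.val hab)
  have hlift : p.scaleRoots s ∈ lifts φ := by
    rw [lifts_iff_coeff_lifts]
    intro i
    rcases lt_or_ge n i with hi | hi
    · refine ⟨0, ?_⟩
      rw [map_zero, coeff_eq_zero_of_natDegree_lt (by rwa [natDegree_scaleRoots])]
    obtain ⟨y, hy⟩ := mem_range_powerSeriesRoot (hN i (by simpa using Nat.lt_succ_of_le hi))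
      fun a ha => by
        rw [hcoeff]
        rcases hi.eq_or_lt with rfl | hi
        · rw [show p.coeff n = 1 from hp]
          simp [coeff_one, ha.ne]
        by_cases hi0 : p.coeff i = 0
        · simp [hi0]
        have hmin := hj i (by simp [S, hi, hi0])
        have hpos : (0 : ℚ) < (n - i : ℕ) := by exact_mod_cast Nat.sub_pos_of_lt hi
        rw [le_div_iff₀ hpos] at hmin
        exact coeff_eq_zero_of_lt_order (by rw [mul_comm]; linarith)
    exact ⟨y, Subtype.ext hy⟩
  obtain ⟨P, hP⟩ := (mem_lifts _).1 hlift
  have hPn : P.natDegree = n := by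
    rw [← natDegree_map_eq_of_injective hφ, hP, natDegree_scaleRoots]
  refine ⟨s, φ, P, ?_, hφ, hP, fun h => ?_⟩
  · intro h
    exact single_ne_zero one_ne_zero (congrArg Subtype.val h)
  · have h1 := congrArg (fun r => r.coeff j) h
    simp only [coeff_map, coeff_X_pow, hPn, if_neg hjn.ne] at h1
    rw [← coeff_zero_powerSeriesRoot N] at h1
    have h2 : powerSeriesRoot K N (P.coeff j) = (p.scaleRoots s).coeff j := by
      rw [← hP, coeff_map]; rfl
    have hpos : ((n - j : ℕ) : ℚ) ≠ 0 := by exact_mod_cast (Nat.sub_pos_of_lt hjn).ne'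
    rw [h2, hcoeff, hq, mul_div_cancel₀ _ hpos, zero_add] at h1
    exact hj0 (Subtype.ext (by simpa [coeff_order_eq_zero] using h1))

theorem eq_sum_single_mul_laurentRoot {n : ℕ+} {x : HahnSeries ℚ K}
    (hx : x ∈ (laurentRoot K n).fieldRange) :
    ∃ y : ℕ → HahnSeries ℤ K,
      x = ∑ i ∈ Finset.range n, single ((i : ℚ) / (n : ℕ)) (1 : K) * laurentRoot K 1 (y i) := by
  have hn : ((n : ℕ) : ℚ) ≠ 0 := by exact_mod_cast n.ne_zero
  rw [mem_fieldRange_laurentRoot_iff] at hx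
  have hmono (i : ℕ) : StrictMono fun m : ℤ => (m : ℚ) + (i : ℚ) / (n : ℕ) := fun a b h => by
    simpa using h
  refine ⟨fun i => x.comapDomain _ (hmono i), ?_⟩
  have hsupp (y : HahnSeries ℤ K) (q : ℚ) (hq : ∀ m : ℤ, q ≠ m) :
      (laurentRoot K 1 y).coeff q = 0 := by
    by_contra hne
    obtain ⟨m, hm⟩ := mem_fieldRange_laurentRoot_iff.1 ⟨y, rfl⟩ q hne
    exact hq m (by simpa using hm)
  have hint (y : HahnSeries ℤ K) (m : ℤ) : (laurentRoot K 1 y).coeff m = y.coeff m := by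
    have h := embDomain_mk_coeff (R := K) (f := intDivHom 1) (intDivHom_strictMono 1).injective
      (fun _ _ => (intDivHom_strictMono 1).le_iff_le) (x := y) (a := m)
    rw [show intDivHom 1 m = m by simp [intDivHom]] at h
    exact h
  ext q
  rw [coeff_sum]
  have hterm (i : ℕ) (y : HahnSeries ℚ K) :
      (single ((i : ℚ) / (n : ℕ)) (1 : K) * y).coeff q = y.coeff (q - (i : ℚ) / (n : ℕ)) := by
    have h := coeff_single_mul_add (r := (1 : K)) (x := y)
      (a := q - (i : ℚ) / (n : ℕ)) (b := (i : ℚ) / (n : ℕ))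
    simpa using h
  simp only [hterm]
  by_cases hq : ∃ m : ℤ, q = (m : ℚ) / (n : ℕ)
  · obtain ⟨m, rfl⟩ := hq
    have hnz : ((n : ℕ) : ℤ) ≠ 0 := by exact_mod_cast n.ne_zero
    have hr0 := Int.emod_nonneg m hnz
    have hrn := Int.emod_lt_of_pos m (show (0 : ℤ) < (n : ℕ) by exact_mod_cast n.pos)
    have hdiv := Int.emod_add_mul_ediv m (n : ℕ)
    set k := m / ((n : ℕ) : ℤ)
    obtain ⟨j, hj⟩ := Int.eq_ofNat_of_zero_le hr0
    rw [hj] at hdiv hrn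
    have hmq : (m : ℚ) / (n : ℕ) = k + (j : ℚ) / (n : ℕ) := by
      rw [← hdiv]; push_cast; field_simp; ring
    rw [Finset.sum_eq_single j]
    · rw [hmq, add_sub_cancel_right, hint]; rfl
    · intro i hi hij
      refine hsupp _ _ fun a ha => hij ?_
      rw [div_sub_div_same, div_eq_iff hn, ← hdiv] at ha
      have ha' : (j : ℤ) + (n : ℕ) * k - i = a * (n : ℕ) := by exact_mod_cast ha
      have hi' := Finset.mem_range.1 hi
      have hmod : (i : ℤ) ≡ j [ZMOD (n : ℕ)] :=
        (Int.modEq_iff_dvd).2 ⟨a - k, by linear_combination ha'⟩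
      exact Nat.ModEq.eq_of_lt_of_lt (Int.natCast_modEq_iff.1 hmod) hi' (by exact_mod_cast hrn)
    · intro h
      exact absurd (Finset.mem_range.2 (by exact_mod_cast hrn)) h
  · rw [Finset.sum_eq_zero]
    · by_contra hne
      exact hq (hx q hne)
    · intro i _
      refine hsupp _ _ fun m hm => hq ⟨m * (n : ℕ) + i, ?_⟩
      push_cast
      rw [sub_eq_iff_eq_add.1 hm]
      field_simp

theorem isAlgebraic_of_mem_puiseux {x : HahnSeries ℚ K} (hx : x ∈ puiseux K) :
    IsAlgebraic (laurentRoot K 1).fieldRange x := by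
  obtain ⟨n, hn⟩ := mem_puiseux.1 hx
  obtain ⟨y, rfl⟩ := eq_sum_single_mul_laurentRoot hn
  have hL (z : HahnSeries ℚ K) (hz : z ∈ (laurentRoot K 1).fieldRange) :
      IsAlgebraic (laurentRoot K 1).fieldRange z :=
    isAlgebraic_algebraMap (⟨z, hz⟩ : (laurentRoot K 1).fieldRange)
  refine sum_mem (S := Subalgebra.algebraicClosure (laurentRoot K 1).fieldRange (HahnSeries ℚ K))
    fun i _ => IsAlgebraic.mul ?_ (hL _ ⟨_, rfl⟩)
  refine IsAlgebraic.of_pow n.pos (hL _ (mem_fieldRange_laurentRoot_iff.2 fun q hq => ⟨i, ?_⟩))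
  have hn0 : ((n : ℕ) : ℚ) ≠ 0 := by exact_mod_cast n.ne_zero
  rw [single_pow] at hq
  have : q = (n : ℕ) • ((i : ℚ) / (n : ℕ)) := by simpa using support_single_subset hq
  rw [this]
  simp [mul_div_cancel₀ _ hn0]

end HahnSeries



/-- Newton–Puiseux theorem: over an algebraically closed field `K` of characteristic zero,
the field of Puiseux series `K⟨⟨t⟩⟩ = ∪_{n ≥ 1} K((t^{1/n}))` — realised inside the Hahn
series field `HahnSeries ℚ K` as the subfield of series whose support has bounded
denominators — is algebraically closed; in particular every element is algebraic over the
Laurent series subfield `K((t))` (series with integer support), so it is the algebraic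
closure of `K((t))`. -/
theorem puiseux_field_alg_closed (K : Type*) [Field K] [IsAlgClosed K] [CharZero K] :
    ∃ (L F : Subfield (HahnSeries ℚ K)),
      (∀ x : HahnSeries ℚ K, x ∈ L ↔ ∀ q ∈ x.support, ∃ m : ℤ, q = (m : ℚ)) ∧
      (∀ x : HahnSeries ℚ K, x ∈ F ↔
        ∃ n : ℕ, 0 < n ∧ ∀ q ∈ x.support, ∃ m : ℤ, q = (m : ℚ) / (n : ℚ)) ∧
      L ≤ F ∧
      IsAlgClosed (↥F) ∧
      (∀ x ∈ F, ∃ p : Polynomial (HahnSeries ℚ K),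
        p ≠ 0 ∧ (∀ j : ℕ, p.coeff j ∈ L) ∧ p.eval x = 0) := by
  refine ⟨(HahnSeries.laurentRoot K 1).fieldRange, HahnSeries.puiseux K, fun x => ?_, fun x => ?_,
    fun x hx => HahnSeries.mem_puiseux.2 ⟨1, hx⟩, ?_, fun x hx => ?_⟩
  · simpa using HahnSeries.mem_fieldRange_laurentRoot_iff (n := 1) (x := x)
  · rw [HahnSeries.mem_puiseux]
    constructor
    · rintro ⟨n, hn⟩
      exact ⟨n, n.pos, HahnSeries.mem_fieldRange_laurentRoot_iff.1 hn⟩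
    · rintro ⟨n, hn, h⟩
      exact ⟨⟨n, hn⟩, HahnSeries.mem_fieldRange_laurentRoot_iff.2 h⟩
  · have : CharZero (HahnSeries ℚ K) :=
      charZero_of_injective_ringHom (HahnSeries.C_injective (Γ := ℚ) (R := K))
    have : CharZero (HahnSeries.puiseux K) :=
      (RingHom.charZero_iff (HahnSeries.puiseux K).subtype_injective).2 this
    exact IsAlgClosed.of_powerSeries_models (K := K) fun p hp hpX =>
      HahnSeries.exists_map_powerSeries_eq_scaleRoots hp hpX
  · obtain ⟨p, hp0, hp⟩ := HahnSeries.isAlgebraic_of_mem_puiseux hx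
    refine ⟨p.map (algebraMap _ _), ?_, fun j => ?_, ?_⟩
    · exact (Polynomial.map_ne_zero_iff (FaithfulSMul.algebraMap_injective _ _)).2 hp0
    · rw [Polynomial.coeff_map]
      exact (p.coeff j).2
    · rwa [Polynomial.eval_map_algebraMap]
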